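/- arXiv:1812.03052 — 13 statements merged into one kernel-verified Lean document; each statement's English description precedes it below -/
import Mathlib

section
/- Let I and J be nonempty finite types, let A : Matrix I J ℂ have rank r, and fix enumerations eI : I ≃ Fin (card I) and eJ : J ≃ Fin (card J). Then there exist a unitary matrix U : Matrix I I ℂ, a unitary matrix V : Matrix J J ℂ, and a matrix D : Matrix I J ℂ such that A = U * D * Vᴴ, where D is 'diagonal' with exactly r positive singular values: D i j = 0 whenever (eI i).val ≠ (eJ j).val or (eI i).val ≥ r, and whenever (eI i).val = (eJ j).val < r the entry D i j is a positive real number. -/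
open Matrix

namespace LinearMap

open Module InnerProductSpace

variable {𝕜 : Type*} [RCLike 𝕜]
  {E : Type*} [NormedAddCommGroup E] [InnerProductSpace 𝕜 E] [FiniteDimensional 𝕜 E]
  {F : Type*} [NormedAddCommGroup F] [InnerProductSpace 𝕜 F] [FiniteDimensional 𝕜 F]

/-- The images under `T` of the eigenvectors of `T.adjoint ∘ₗ T` are pairwise orthogonal, and their
norms are the singular values of `T`. -/
theorem inner_apply_eigenvectorBasis_adjoint_comp_self (T : E →ₗ[𝕜] F) {n : ℕ}
    (hn : finrank 𝕜 E = n) (i j : Fin n) :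
    inner 𝕜 (T (T.isSymmetric_adjoint_comp_self.eigenvectorBasis hn i))
      (T (T.isSymmetric_adjoint_comp_self.eigenvectorBasis hn j)) =
        if i = j then (T.singularValues j : 𝕜) ^ 2 else 0 := by
  have hT := T.isSymmetric_adjoint_comp_self.apply_eigenvectorBasis hn j
  rw [comp_apply] at hT
  rw [← adjoint_inner_right, hT, inner_smul_right, ← T.sq_singularValues_fin hn j,
    orthonormal_iff_ite.mp (OrthonormalBasis.orthonormal _) i j]
  simp

/-- **Singular value decomposition** of a linear map between finite-dimensional inner product
spaces. -/
theorem exists_orthonormalBasis_apply_eq_singularValues_smul (T : E →ₗ[𝕜] F) {m n : ℕ}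
    (hm : finrank 𝕜 F = m) (hn : finrank 𝕜 E = n) :
    ∃ (u : OrthonormalBasis (Fin m) 𝕜 F) (v : OrthonormalBasis (Fin n) 𝕜 E), ∀ i j,
      u.repr (T (v j)) i = if (i : ℕ) = j then (T.singularValues j : 𝕜) else 0 := by
  set v := T.isSymmetric_adjoint_comp_self.eigenvectorBasis hn with hv
  have hinner := T.inner_apply_eigenvectorBasis_adjoint_comp_self hn
  rw [← hv] at hinner
  have hrn : finrank 𝕜 T.range ≤ n := hn ▸ T.finrank_range_le
  have hrm : finrank 𝕜 T.range ≤ m := hm ▸ Submodule.finrank_le _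
  let w : Fin m → F := fun i ↦
    if h : (i : ℕ) < n then (T.singularValues i : 𝕜)⁻¹ • T (v ⟨i, h⟩) else 0
  let s : Set (Fin m) := {i | (i : ℕ) < finrank 𝕜 T.range}
  have hpos : ∀ k < finrank 𝕜 T.range, (T.singularValues k : 𝕜) ≠ 0 := fun k hk ↦
    RCLike.ofReal_ne_zero.mpr (T.singularValues_pos_iff_lt_finrank_range.mpr hk).ne'
  have hw : Orthonormal 𝕜 (s.domRestrict w) := by
    rw [orthonormal_iff_ite]
    rintro ⟨i, hi⟩ ⟨j, hj⟩
    have hi' : (i : ℕ) < n := lt_of_lt_of_le hi hrn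
    have hj' : (j : ℕ) < n := lt_of_lt_of_le hj hrn
    simp only [Set.domRestrict_apply, w, dif_pos hi', dif_pos hj', inner_smul_left,
      inner_smul_right, hinner, Fin.mk.injEq, Subtype.mk.injEq, Fin.val_inj]
    split_ifs with h
    · subst h
      have := hpos i hi
      simp only [map_inv₀, RCLike.conj_ofReal]
      field_simp
    · simp
  obtain ⟨u, hu⟩ := hw.exists_orthonormalBasis_extension_of_card_eq (by simpa using hm)
  refine ⟨u, v, fun i j ↦ ?_⟩
  by_cases hj : (j : ℕ) < finrank 𝕜 T.range
  · have hTv : T (v j) = (T.singularValues j : 𝕜) • u ⟨j, hj.trans_le hrm⟩ := by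
      rw [hu ⟨j, hj.trans_le hrm⟩ hj]
      simp [w, smul_smul, mul_inv_cancel₀ (hpos j hj)]
    rw [hTv, OrthonormalBasis.repr_apply_apply, inner_smul_right,
      orthonormal_iff_ite.mp u.orthonormal]
    simp [Fin.ext_iff]
  · have hσ : T.singularValues j = 0 :=
      T.singularValues_eq_zero_iff_le_finrank_range.mpr (not_lt.mp hj)
    have hTv : T (v j) = 0 := by
      rw [← inner_self_eq_zero (𝕜 := 𝕜), hinner, hσ]
      simp
    simp [hTv, hσ]

end LinearMap

theorem svd_arbitrary_order
    {I J : Type*} [Fintype I] [Fintype J] [DecidableEq I] [DecidableEq J]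
    [Nonempty I] [Nonempty J]
    (A : Matrix I J ℂ) (r : ℕ) (hr : A.rank = r)
    (eI : I ≃ Fin (Fintype.card I)) (eJ : J ≃ Fin (Fintype.card J)) :
    ∃ (U : Matrix I I ℂ) (V : Matrix J J ℂ) (D : Matrix I J ℂ),
      U * Uᴴ = 1 ∧ Uᴴ * U = 1 ∧ V * Vᴴ = 1 ∧ Vᴴ * V = 1 ∧
      A = U * D * Vᴴ ∧
      (∀ i j, ((eI i : ℕ) ≠ (eJ j : ℕ) ∨ r ≤ (eI i : ℕ)) → D i j = 0) ∧
      (∀ i j, (eI i : ℕ) = (eJ j : ℕ) → (eI i : ℕ) < r →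
        ∃ s : ℝ, 0 < s ∧ D i j = (s : ℂ)) := by
  let bI := EuclideanSpace.basisFun I ℂ
  let bJ := EuclideanSpace.basisFun J ℂ
  let T := Matrix.toLin bJ.toBasis bI.toBasis A
  have hT : Module.finrank ℂ T.range = r := by
    rw [← hr, A.rank_eq_finrank_range_toLin bI.toBasis bJ.toBasis]
  obtain ⟨u, v, huv⟩ := T.exists_orthonormalBasis_apply_eq_singularValues_smul
    finrank_euclideanSpace finrank_euclideanSpace
  let u' := u.reindex eI.symm
  let v' := v.reindex eJ.symm
  have hD : ∀ i j, LinearMap.toMatrix v'.toBasis u'.toBasis T i j =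
      if (eI i : ℕ) = eJ j then (T.singularValues (eJ j) : ℂ) else 0 := fun i j ↦ by
    simpa [LinearMap.toMatrix_apply, u', v'] using huv (eI i) (eJ j)
  have hV : (bJ.toBasis.toMatrix v')ᴴ = v'.toBasis.toMatrix bJ := by
    refine left_inv_eq_right_inv (bJ.toMatrix_orthonormalBasis_conjTranspose_mul_self v') ?_
    simpa using bJ.toBasis.toMatrix_mul_toMatrix_flip v'.toBasis
  refine ⟨bI.toBasis.toMatrix u', bJ.toBasis.toMatrix v', LinearMap.toMatrix v'.toBasis u'.toBasis T,
    bI.toMatrix_orthonormalBasis_self_mul_conjTranspose u',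
    bI.toMatrix_orthonormalBasis_conjTranspose_mul_self u',
    bJ.toMatrix_orthonormalBasis_self_mul_conjTranspose v',
    bJ.toMatrix_orthonormalBasis_conjTranspose_mul_self v', ?_, fun i j h ↦ ?_, fun i j h hi ↦ ?_⟩
  · have := basis_toMatrix_mul_linearMap_toMatrix_mul_basis_toMatrix
      bJ.toBasis v'.toBasis bI.toBasis u'.toBasis T
    rw [LinearMap.toMatrix_toLin] at this
    rw [hV, ← this]
    simp
  · rw [hD]
    split_ifs with hij
    · rw [T.singularValues_eq_zero_iff_le_finrank_range.mpr, Complex.ofReal_zero]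
      rw [hT, ← hij]
      exact h.resolve_left (not_not.mpr hij)
    · rfl
  · refine ⟨T.singularValues (eJ j), ?_, by rw [hD, if_pos h]⟩
    rw [T.singularValues_pos_iff_lt_finrank_range, hT, ← h]
    exact hi
end

section
/- For every matrix A : Matrix I J ℂ (I, J finite types) there exists exactly one matrix X : Matrix J I ℂ satisfying the four Penrose equations: A * X * A = A, X * A * X = X, (A * X)ᴴ = A * X, and (X * A)ᴴ = X * A. -/
open Matrix

/-- A Hermitian matrix has a Hermitian reflexive generalized inverse commuting with it. -/
theorem Matrix.IsHermitian.exists_commuting_generalized_inverse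
    {𝕜 n : Type*} [RCLike 𝕜] [Fintype n] {H : Matrix n n 𝕜} (hH : H.IsHermitian) :
    ∃ G : Matrix n n 𝕜, G.IsHermitian ∧ H * G = G * H ∧ H * G * H = H ∧ G * H * G = G := by
  classical
  set φ := Unitary.conjStarAlgAut 𝕜 (Matrix n n 𝕜) hH.eigenvectorUnitary
  let d : n → 𝕜 := fun i => (hH.eigenvalues i : 𝕜)
  let e : n → 𝕜 := fun i => ((hH.eigenvalues i)⁻¹ : ℝ)
  have hφ : H = φ (diagonal d) := hH.spectral_theorem
  refine ⟨φ (diagonal e), ?_, ?_, ?_, ?_⟩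
  · change star (φ (diagonal e)) = φ (diagonal e)
    rw [← map_star, star_eq_conjTranspose, diagonal_conjTranspose]
    congr 2
    ext i
    simp [e]
  all_goals
    rw [hφ]
    simp only [← map_mul, diagonal_mul_diagonal]
    congr 2
    ext i
    by_cases hi : (hH.eigenvalues i : 𝕜) = 0 <;> simp [d, e, hi]

open scoped ComplexOrder in
theorem Matrix.exists_moore_penrose_inverse
    {𝕜 m n : Type*} [RCLike 𝕜] [Fintype m] [Fintype n] (A : Matrix m n 𝕜) :
    ∃ X : Matrix n m 𝕜,
      A * X * A = A ∧ X * A * X = X ∧ (A * X)ᴴ = A * X ∧ (X * A)ᴴ = X * A := by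
  classical
  obtain ⟨G, hG, hcomm, hHGH, hGHG⟩ :=
    (isHermitian_conjTranspose_mul_self A).exists_commuting_generalized_inverse
  refine ⟨G * Aᴴ, ?_, ?_, ?_, ?_⟩
  · have h : Aᴴ * A * (G * (Aᴴ * A) - 1) = 0 := by
      rw [Matrix.mul_sub, ← Matrix.mul_assoc, hHGH, Matrix.mul_one, sub_self]
    rw [conjTranspose_mul_self_mul_eq_zero, Matrix.mul_sub, Matrix.mul_one, sub_eq_zero] at h
    simpa only [Matrix.mul_assoc] using h
  · simpa only [Matrix.mul_assoc] using congrArg (· * Aᴴ) hGHG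
  · simp only [conjTranspose_mul, conjTranspose_conjTranspose, hG.eq, Matrix.mul_assoc]
  · rw [Matrix.mul_assoc, conjTranspose_mul, hG.eq,
      (isHermitian_conjTranspose_mul_self A).eq, hcomm]

theorem Matrix.moore_penrose_inverse_unique
    {R m n : Type*} [Semiring R] [StarRing R] [Fintype m] [Fintype n]
    {A : Matrix m n R} {X Y : Matrix n m R}
    (hX : A * X * A = A ∧ X * A * X = X ∧ (A * X)ᴴ = A * X ∧ (X * A)ᴴ = X * A)
    (hY : A * Y * A = A ∧ Y * A * Y = Y ∧ (A * Y)ᴴ = A * Y ∧ (Y * A)ᴴ = Y * A) :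
    X = Y := by
  obtain ⟨hX₁, hX₂, hX₃, hX₄⟩ := hX
  obtain ⟨hY₁, hY₂, hY₃, hY₄⟩ := hY
  have hl : A * X = A * Y := by
    calc A * X = (A * Y * (A * X))ᴴ := by rw [← Matrix.mul_assoc, hY₁, hX₃]
      _ = A * X * (A * Y) := by rw [conjTranspose_mul, hX₃, hY₃]
      _ = A * Y := by rw [← Matrix.mul_assoc, hX₁]
  have hr : X * A = Y * A := by
    calc X * A = (X * A * (Y * A))ᴴ := by
          rw [Matrix.mul_assoc, ← Matrix.mul_assoc A, hY₁, hX₄]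
      _ = Y * A * (X * A) := by rw [conjTranspose_mul, hX₄, hY₄]
      _ = Y * A := by rw [Matrix.mul_assoc, ← Matrix.mul_assoc A, hX₁]
  rw [← hX₂, hr, Matrix.mul_assoc, hl, ← Matrix.mul_assoc, hY₂]

theorem moore_penrose_exists_unique
    {I J : Type*} [Fintype I] [Fintype J]
    (A : Matrix I J ℂ) :
    ∃! X : Matrix J I ℂ,
      A * X * A = A ∧ X * A * X = X ∧ (A * X)ᴴ = A * X ∧ (X * A)ᴴ = X * A := by
  obtain ⟨X, hX⟩ := exists_moore_penrose_inverse A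
  exact ⟨X, hX, fun _ hY => moore_penrose_inverse_unique hY hX⟩
end

section
/- Let A : Matrix I J ℂ, let X be the Moore–Penrose inverse of A, let Y be the Moore–Penrose inverse of Aᴴ, let P be the Moore–Penrose inverse of Aᴴ * A, and let Q be the Moore–Penrose inverse of A * Aᴴ. Then: (a) Aᴴ = X * A * Aᴴ and Aᴴ = Aᴴ * A * X; (b) A = A * Aᴴ * Y and A = Y * Aᴴ * A; (c) X = P * Aᴴ and X = Aᴴ * Q. -/
open Matrix

/-- `X` is a Moore–Penrose inverse of `A`. -/
def IsMPInv {I J : Type*} [Fintype I] [Fintype J]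
    (A : Matrix I J ℂ) (X : Matrix J I ℂ) : Prop :=
  A * X * A = A ∧ X * A * X = X ∧ (A * X)ᴴ = A * X ∧ (X * A)ᴴ = X * A

namespace IsMPInv

variable {I J : Type*} [Fintype I] [Fintype J] {A : Matrix I J ℂ} {X : Matrix J I ℂ}

theorem mul_mul_conjTranspose (h : IsMPInv A X) : X * A * Aᴴ = Aᴴ := by
  obtain ⟨h₁, -, -, h₄⟩ := h
  rw [← h₄, ← conjTranspose_mul, ← Matrix.mul_assoc, h₁]

theorem conjTranspose_mul_mul (h : IsMPInv A X) : Aᴴ * A * X = Aᴴ := by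
  obtain ⟨h₁, -, h₃, -⟩ := h
  rw [Matrix.mul_assoc, ← h₃, ← conjTranspose_mul, h₁]

theorem eq_mul_conjTranspose (h : IsMPInv A X) {P : Matrix J J ℂ}
    (hP : IsMPInv (Aᴴ * A) P) : X = P * Aᴴ := by
  have hc := h.conjTranspose_mul_mul
  obtain ⟨h₁, h₂, h₃, h₄⟩ := h
  obtain ⟨k₁, -, -, k₄⟩ := hP
  have cancel : Xᴴ * (Aᴴ * A) = A := by
    rw [← Matrix.mul_assoc, ← conjTranspose_mul, h₃, h₁]
  have hA : A * (P * (Aᴴ * A)) = A := by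
    have := congrArg (Xᴴ * ·) k₁
    simpa only [Matrix.mul_assoc (Aᴴ * A), ← Matrix.mul_assoc Xᴴ (Aᴴ * A), cancel] using this
  have hproj : X * A = P * (Aᴴ * A) := by
    have h₅ : P * (Aᴴ * A) * (X * A) = P * (Aᴴ * A) := by
      rw [Matrix.mul_assoc, ← Matrix.mul_assoc (Aᴴ * A), hc]
    have h₆ := congrArg conjTranspose h₅
    rw [conjTranspose_mul, h₄, k₄, Matrix.mul_assoc, hA] at h₆
    exact h₆
  calc
    X = X * A * X := h₂.symm
    _ = P * Aᴴ := by rw [hproj, Matrix.mul_assoc, hc]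

theorem eq_conjTranspose_mul (h : IsMPInv A X) {Q : Matrix I I ℂ}
    (hQ : IsMPInv (A * Aᴴ) Q) : X = Aᴴ * Q := by
  have hc := h.mul_mul_conjTranspose
  obtain ⟨h₁, h₂, h₃, h₄⟩ := h
  obtain ⟨k₁, -, k₃, -⟩ := hQ
  have cancel : A * Aᴴ * Xᴴ = A := by
    rw [Matrix.mul_assoc, ← conjTranspose_mul, h₄, ← Matrix.mul_assoc, h₁]
  have hA : A * Aᴴ * Q * A = A := by
    have := congrArg (· * Xᴴ) k₁
    simpa only [Matrix.mul_assoc (A * Aᴴ * Q), cancel] using this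
  have hproj : A * X = A * Aᴴ * Q := by
    have h₅ : A * X * (A * Aᴴ * Q) = A * Aᴴ * Q := by
      rw [← Matrix.mul_assoc, ← Matrix.mul_assoc, h₁]
    have h₆ := congrArg conjTranspose h₅
    rw [conjTranspose_mul, h₃, k₃, ← Matrix.mul_assoc, hA] at h₆
    exact h₆
  calc
    X = X * (A * X) := by rw [← Matrix.mul_assoc, h₂]
    _ = Aᴴ * Q := by rw [hproj, ← Matrix.mul_assoc, ← Matrix.mul_assoc, hc]

end IsMPInv

theorem mp_identities
    {I J : Type*} [Fintype I] [Fintype J]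
    (A : Matrix I J ℂ)
    (X : Matrix J I ℂ) (hX : IsMPInv A X)
    (Y : Matrix I J ℂ) (hY : IsMPInv Aᴴ Y)
    (P : Matrix J J ℂ) (hP : IsMPInv (Aᴴ * A) P)
    (Q : Matrix I I ℂ) (hQ : IsMPInv (A * Aᴴ) Q) :
    (Aᴴ = X * A * Aᴴ ∧ Aᴴ = Aᴴ * A * X) ∧
    (A = A * Aᴴ * Y ∧ A = Y * Aᴴ * A) ∧
    (X = P * Aᴴ ∧ X = Aᴴ * Q) := by
  have hb₁ := hY.conjTranspose_mul_mul
  have hb₂ := hY.mul_mul_conjTranspose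
  rw [conjTranspose_conjTranspose] at hb₁ hb₂
  exact ⟨⟨hX.mul_mul_conjTranspose.symm, hX.conjTranspose_mul_mul.symm⟩,
    ⟨hb₁.symm, hb₂.symm⟩,
    ⟨hX.eq_mul_conjTranspose hP, hX.eq_conjTranspose_mul hQ⟩⟩
end

section
/- Let A : Matrix I J ℂ and B : Matrix I K ℂ, let X be the Moore–Penrose inverse of A and Y the Moore–Penrose inverse of B. Then R(A) = R(B) if and only if A * X = B * Y. -/
open Matrix

/-- If `X` is an inner inverse of `A`, then `A * X` fixes `B` exactly when the range of `B` is
contained in that of `A`. -/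
theorem range_mulVec_subset_iff_mul_mul_eq {R I J K : Type*} [CommSemiring R]
    [Fintype I] [Fintype J] [Fintype K]
    {A : Matrix I J R} {X : Matrix J I R} (hX : A * X * A = A) (B : Matrix I K R) :
    Set.range B.mulVec ⊆ Set.range A.mulVec ↔ A * X * B = B := by
  constructor
  · intro h
    apply Matrix.mulVec_injective
    funext v
    obtain ⟨w, hw⟩ := h ⟨v, rfl⟩
    rw [← Matrix.mulVec_mulVec, ← hw, Matrix.mulVec_mulVec, hX]
  · rintro h _ ⟨v, rfl⟩
    exact ⟨(X * B).mulVec v, by rw [Matrix.mulVec_mulVec, ← Matrix.mul_assoc, h]⟩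

theorem range_eq_iff_mp_proj_eq
    {I J K : Type*} [Fintype I] [Fintype J] [Fintype K]
    (A : Matrix I J ℂ) (B : Matrix I K ℂ)
    (X : Matrix J I ℂ) (hX : IsMPInv A X)
    (Y : Matrix K I ℂ) (hY : IsMPInv B Y) :
    Set.range A.mulVec = Set.range B.mulVec ↔ A * X = B * Y := by
  obtain ⟨hA, -, hAX, -⟩ := hX
  obtain ⟨hB, -, hBY, -⟩ := hY
  rw [Set.Subset.antisymm_iff, range_mulVec_subset_iff_mul_mul_eq hB,
    range_mulVec_subset_iff_mul_mul_eq hA]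
  constructor
  · rintro ⟨hBA, hAB⟩
    calc A * X = (B * Y * (A * X))ᴴ := by rw [← Matrix.mul_assoc, hBA, hAX]
      _ = A * X * (B * Y) := by rw [conjTranspose_mul, hAX, hBY]
      _ = B * Y := by rw [← Matrix.mul_assoc, hAB]
  · intro h
    exact ⟨by rw [← h, hA], by rw [h, hB]⟩
end

section
/- Let A : Matrix I J ℂ, and let M : Matrix I I ℂ and N : Matrix J J ℂ be Hermitian positive definite matrices. Then there exists exactly one matrix X : Matrix J I ℂ satisfying the four weighted Penrose equations: A * X * A = A, X * A * X = X, (M * A * X)ᴴ = M * A * X, and (N * X * A)ᴴ = N * X * A. -/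
open Matrix
open scoped ComplexOrder

/-- Every matrix over a field has an inner generalized inverse. -/
theorem Matrix.exists_mul_mul_eq_self {K m n : Type*} [Field K] [Fintype m] [Fintype n]
    (A : Matrix m n K) : ∃ G : Matrix n m K, A * G * A = A := by
  classical
  obtain ⟨s, hs⟩ := (toLin' A).rangeRestrict.exists_rightInverse_of_surjective
    (LinearMap.range_rangeRestrict _)
  obtain ⟨g, hg⟩ := LinearMap.exists_extend s
  refine ⟨LinearMap.toMatrix' g, (toLin' (R := K)).injective ?_⟩
  rw [toLin'_mul, toLin'_mul, toLin'_toMatrix']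
  refine LinearMap.ext fun x => ?_
  have h₁ := LinearMap.congr_fun hg ((toLin' A).rangeRestrict x)
  have h₂ := congrArg Subtype.val (LinearMap.congr_fun hs ((toLin' A).rangeRestrict x))
  change g (toLin' A x) = _ at h₁
  change toLin' A (g (toLin' A x)) = _
  rw [h₁]
  exact h₂

theorem Matrix.PosDef.eq_zero_of_conjTranspose_mul_mul_eq_zero {m n : Type*}
    [Fintype m] [Fintype n] {M : Matrix m m ℂ} (hM : M.PosDef) {D : Matrix m n ℂ}
    (h : Dᴴ * M * D = 0) : D = 0 := by
  refine ext_iff_mulVec.mpr fun v => ?_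
  rw [zero_mulVec]
  by_contra hv
  have hpos := hM.dotProduct_mulVec_pos hv
  rw [star_mulVec, ← dotProduct_mulVec, mulVec_mulVec, mulVec_mulVec, h,
    zero_mulVec, dotProduct_zero] at hpos
  exact lt_irrefl _ hpos

/-- An inner inverse whose range projection is self-adjoint for the inner product given by `M`. -/
theorem Matrix.PosDef.exists_inner_inverse_left {m n : Type*} [Fintype m] [Fintype n]
    {M : Matrix m m ℂ} (hM : M.PosDef) (A : Matrix m n ℂ) :
    ∃ G : Matrix n m ℂ, A * G * A = A ∧ (M * A * G)ᴴ = M * A * G := by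
  classical
  have hMh : Mᴴ = M := hM.isHermitian
  have key : ∀ g : Matrix n n ℂ, Aᴴ * M * A * g * (Aᴴ * M * A) = Aᴴ * M * A →
      A * g * (Aᴴ * M * A) = A := by
    intro g hg
    have h₀ : Aᴴ * M * (A * g * (Aᴴ * M * A) - A) = 0 := by
      rw [Matrix.mul_sub, sub_eq_zero]
      simpa only [Matrix.mul_assoc] using hg
    refine sub_eq_zero.mp (hM.eq_zero_of_conjTranspose_mul_mul_eq_zero ?_)
    have h₁ : A * g * (Aᴴ * M * A) - A = A * (g * (Aᴴ * M * A) - 1) := by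
      rw [Matrix.mul_sub, Matrix.mul_one, Matrix.mul_assoc]
    have h₂ : (A * g * (Aᴴ * M * A) - A)ᴴ = (g * (Aᴴ * M * A) - 1)ᴴ * Aᴴ := by
      rw [h₁, conjTranspose_mul]
    rw [h₂, Matrix.mul_assoc, Matrix.mul_assoc, ← Matrix.mul_assoc Aᴴ, h₀, Matrix.mul_zero]
  obtain ⟨g, hg⟩ := (Aᴴ * M * A).exists_mul_mul_eq_self
  have hg' : Aᴴ * M * A * gᴴ * (Aᴴ * M * A) = Aᴴ * M * A := by
    simpa only [conjTranspose_mul, conjTranspose_conjTranspose, hMh, Matrix.mul_assoc]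
      using congrArg Matrix.conjTranspose hg
  refine ⟨g * Aᴴ * M, ?_, ?_⟩
  · simpa only [Matrix.mul_assoc] using key g hg
  · have h₁ : M * A * (g * Aᴴ * M) = (A * g * Aᴴ * M)ᴴ * M * (A * g * Aᴴ * M) := by
      calc M * A * (g * Aᴴ * M) = M * (A * gᴴ * (Aᴴ * M * A)) * (g * Aᴴ * M) := by
            rw [key _ hg']
        _ = _ := by
            simp only [conjTranspose_mul, conjTranspose_conjTranspose, hMh, Matrix.mul_assoc]
    rw [h₁]
    exact isHermitian_conjTranspose_mul_mul _ hMh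

/-- An inner inverse whose corange projection is self-adjoint for the inner product given by
`N`. -/
theorem Matrix.PosDef.exists_inner_inverse_right {m n : Type*} [Fintype m] [Fintype n]
    {N : Matrix n n ℂ} (hN : N.PosDef) (A : Matrix m n ℂ) :
    ∃ H : Matrix n m ℂ, A * H * A = A ∧ (N * H * A)ᴴ = N * H * A := by
  classical
  have hNh : Nᴴ = N := hN.isHermitian
  have hu : IsUnit N.det := (isUnit_iff_isUnit_det N).mp hN.isUnit
  obtain ⟨G, hG, hGN⟩ := hN.inv.exists_inner_inverse_left Aᴴ
  refine ⟨Gᴴ, ?_, ?_⟩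
  · simpa only [conjTranspose_mul, conjTranspose_conjTranspose, Matrix.mul_assoc]
      using congrArg Matrix.conjTranspose hG
  · simp only [conjTranspose_mul, conjTranspose_conjTranspose, conjTranspose_nonsing_inv,
      hNh] at hGN ⊢
    calc Aᴴ * (G * N) = N * (N⁻¹ * Aᴴ * G) * N := by
          rw [Matrix.mul_assoc N⁻¹, mul_nonsing_inv_cancel_left _ _ hu, Matrix.mul_assoc]
      _ = N * Gᴴ * A := by
          rw [← hGN]
          simp only [Matrix.mul_assoc, nonsing_inv_mul _ hu, Matrix.mul_one]

theorem weighted_moore_penrose_exists_unique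
    {I J : Type*} [Fintype I] [Fintype J]
    (A : Matrix I J ℂ) (M : Matrix I I ℂ) (N : Matrix J J ℂ)
    (hMh : Mᴴ = M) (hM : M.PosDef) (hNh : Nᴴ = N) (hN : N.PosDef) :
    ∃! X : Matrix J I ℂ,
      A * X * A = A ∧ X * A * X = X ∧
      (M * A * X)ᴴ = M * A * X ∧ (N * X * A)ᴴ = N * X * A := by
  classical
  obtain ⟨G, hG, hGM⟩ := hM.exists_inner_inverse_left A
  obtain ⟨H, hH, hHN⟩ := hN.exists_inner_inverse_right A
  refine existsUnique_of_exists_of_unique ⟨H * A * G, ?_, ?_, ?_, ?_⟩ ?_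
  · calc A * (H * A * G) * A = A * H * A * G * A := by simp only [Matrix.mul_assoc]
      _ = A := by rw [hH, hG]
  · calc H * A * G * A * (H * A * G) = H * (A * G * A) * H * A * G := by
          simp only [Matrix.mul_assoc]
      _ = H * (A * H * A) * G := by rw [hG]; simp only [Matrix.mul_assoc]
      _ = H * A * G := by rw [hH]
  · have h : M * A * (H * A * G) = M * A * G := by
      calc M * A * (H * A * G) = M * (A * H * A) * G := by simp only [Matrix.mul_assoc]
        _ = M * A * G := by rw [hH]
    rw [h, hGM]
  · have h : N * (H * A * G) * A = N * H * A := by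
      calc N * (H * A * G) * A = N * H * (A * G * A) := by simp only [Matrix.mul_assoc]
        _ = N * H * A := by rw [hG]
    rw [h, hHN]
  · rintro X Y ⟨hX₁, hX₂, hX₃, hX₄⟩ ⟨hY₁, hY₂, hY₃, hY₄⟩
    have hAX : A * X = A * Y := by
      refine hM.isUnit.mul_left_cancel ?_
      calc M * (A * X) = (M * A * X)ᴴ := by rw [hX₃, Matrix.mul_assoc]
        _ = (M * (A * Y * A) * X)ᴴ := by rw [hY₁]
        _ = (A * X)ᴴ * (M * A * Y)ᴴ := by
            rw [← conjTranspose_mul]; simp only [Matrix.mul_assoc]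
        _ = (M * A * X)ᴴ * (A * Y) := by
            rw [hY₃]; simp only [conjTranspose_mul, hMh, Matrix.mul_assoc]
        _ = M * (A * X * A) * Y := by rw [hX₃]; simp only [Matrix.mul_assoc]
        _ = M * (A * Y) := by rw [hX₁, Matrix.mul_assoc]
    have hXA : X * A = Y * A := by
      refine hN.isUnit.mul_left_cancel ?_
      calc N * (X * A) = N * X * (A * Y * A) := by rw [hY₁, Matrix.mul_assoc]
        _ = N * X * A * (Y * A) := by simp only [Matrix.mul_assoc]
        _ = (X * A)ᴴ * (N * Y * A) := by
            rw [← hX₄]; simp only [conjTranspose_mul, hNh, Matrix.mul_assoc]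
        _ = (N * Y * (A * X * A))ᴴ := by
            rw [← hY₄, ← conjTranspose_mul]; simp only [Matrix.mul_assoc]
        _ = N * (Y * A) := by rw [hX₁, hY₄, Matrix.mul_assoc]
    rw [← hX₂, Matrix.mul_assoc, hAX, ← Matrix.mul_assoc, hXA, hY₂]
end

section
/- Let A : Matrix I J ℂ, let M : Matrix I I ℂ and N : Matrix J J ℂ be Hermitian positive definite, and let SM : Matrix I I ℂ and SN : Matrix J J ℂ be Hermitian positive definite matrices with SM * SM = M and SN * SN = N. If G : Matrix J I ℂ is the Moore–Penrose inverse of SM * A * SN⁻¹, then X := SN⁻¹ * G * SM satisfies the four weighted Penrose equations for A with respect to (M, N): A * X * A = A, X * A * X = X, (M * A * X)ᴴ = M * A * X, and (N * X * A)ᴴ = N * X * A. -/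
open Matrix
open scoped ComplexOrder

theorem weighted_mp_via_square_roots
    {I J : Type*} [Fintype I] [Fintype J] [DecidableEq I] [DecidableEq J]
    (A : Matrix I J ℂ) (M SM : Matrix I I ℂ) (N SN : Matrix J J ℂ)
    (hMh : Mᴴ = M) (hM : M.PosDef) (hNh : Nᴴ = N) (hN : N.PosDef)
    (hSMh : SMᴴ = SM) (hSM : SM.PosDef) (hSNh : SNᴴ = SN) (hSN : SN.PosDef)
    (hSM2 : SM * SM = M) (hSN2 : SN * SN = N)
    (G : Matrix J I ℂ) (hG : IsMPInv (SM * A * SN⁻¹) G) :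
    A * (SN⁻¹ * G * SM) * A = A ∧
    (SN⁻¹ * G * SM) * A * (SN⁻¹ * G * SM) = SN⁻¹ * G * SM ∧
    (M * A * (SN⁻¹ * G * SM))ᴴ = M * A * (SN⁻¹ * G * SM) ∧
    (N * (SN⁻¹ * G * SM) * A)ᴴ = N * (SN⁻¹ * G * SM) * A := by
  obtain ⟨h1, h2, h3, h4⟩ := hG
  have hM1 : SM⁻¹ * SM = 1 :=
    nonsing_inv_mul SM ((isUnit_iff_isUnit_det SM).mp hSM.isUnit)
  have hN0 : IsUnit SN.det := (isUnit_iff_isUnit_det SN).mp hSN.isUnit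
  have hN1 : SN⁻¹ * SN = 1 := nonsing_inv_mul SN hN0
  have hN2 : SN * SN⁻¹ = 1 := mul_nonsing_inv SN hN0
  have hA : SM⁻¹ * (SM * A * SN⁻¹) * SN = A := by
    calc SM⁻¹ * (SM * A * SN⁻¹) * SN
        = (SM⁻¹ * SM) * A * (SN⁻¹ * SN) := by simp only [Matrix.mul_assoc]
      _ = A := by rw [hM1, hN1, Matrix.one_mul, Matrix.mul_one]
  refine ⟨?_, ?_, ?_, ?_⟩
  · calc A * (SN⁻¹ * G * SM) * A
        = (SM⁻¹ * SM) * A * (SN⁻¹ * G * SM) * A * (SN⁻¹ * SN) := by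
          rw [hM1, hN1, Matrix.one_mul, Matrix.mul_one]
      _ = SM⁻¹ * (SM * A * SN⁻¹ * G * (SM * A * SN⁻¹)) * SN := by
          simp only [Matrix.mul_assoc]
      _ = A := by rw [h1, hA]
  · calc SN⁻¹ * G * SM * A * (SN⁻¹ * G * SM)
        = SN⁻¹ * (G * (SM * A * SN⁻¹) * G) * SM := by simp only [Matrix.mul_assoc]
      _ = SN⁻¹ * G * SM := by rw [h2]
  · have h : M * A * (SN⁻¹ * G * SM) = SM * (SM * A * SN⁻¹ * G) * SM := by
      rw [← hSM2]
      simp only [Matrix.mul_assoc]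
    rw [h, conjTranspose_mul, conjTranspose_mul, h3, hSMh, ← Matrix.mul_assoc SM]
  · have h : N * (SN⁻¹ * G * SM) * A = SN * (G * (SM * A * SN⁻¹)) * SN := by
      calc N * (SN⁻¹ * G * SM) * A
          = SN * (SN * SN⁻¹) * G * SM * A := by
            rw [← hSN2]
            simp only [Matrix.mul_assoc]
        _ = SN * G * SM * A * (SN⁻¹ * SN) := by
            rw [hN1, hN2, Matrix.mul_one, Matrix.mul_one]
        _ = SN * (G * (SM * A * SN⁻¹)) * SN := by simp only [Matrix.mul_assoc]
    rw [h, conjTranspose_mul, conjTranspose_mul, h4, hSNh, ← Matrix.mul_assoc SN]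
end

section
/- Let A : Matrix I J ℂ, let M : Matrix I I ℂ and N : Matrix J J ℂ be Hermitian positive definite, and let SM, SN be Hermitian positive definite matrices with SM * SM = M and SN * SN = N. Let X be the Moore–Penrose inverse of A, let Y be the Moore–Penrose inverse of SM * A, and let Z be the Moore–Penrose inverse of A * SN⁻¹. Then (a) Y * SM * A = X * A, and (b) A * SN⁻¹ * Z = A * X. -/
open Matrix
open scoped ComplexOrder

/-- Two Hermitian matrices that absorb each other on the right are equal. -/
theorem Matrix.IsHermitian.eq_of_mul_eq_left {n α : Type*} [Fintype n] [NonUnitalSemiring α]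
    [StarRing α] {P Q : Matrix n n α} (hP : P.IsHermitian) (hQ : Q.IsHermitian)
    (hPQ : P * Q = P) (hQP : Q * P = Q) : P = Q := by
  have h := congrArg Matrix.conjTranspose hPQ
  rw [conjTranspose_mul, hP.eq, hQ.eq, hQP] at h
  exact h.symm

/-- Two Hermitian matrices that absorb each other on the left are equal. -/
theorem Matrix.IsHermitian.eq_of_mul_eq_right {n α : Type*} [Fintype n] [NonUnitalSemiring α]
    [StarRing α] {P Q : Matrix n n α} (hP : P.IsHermitian) (hQ : Q.IsHermitian)
    (hPQ : P * Q = Q) (hQP : Q * P = P) : P = Q := by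
  have h := congrArg Matrix.conjTranspose hPQ
  rw [conjTranspose_mul, hP.eq, hQ.eq, hQP] at h
  exact h

/-- Multiplying on the left by an invertible matrix preserves the projection `X * A`. -/
theorem IsMPInv.mul_eq_of_isUnit_left {I J : Type*} [Fintype I] [Fintype J] [DecidableEq I]
    {A : Matrix I J ℂ} {S : Matrix I I ℂ} {X Y : Matrix J I ℂ} (hS : IsUnit S)
    (hX : IsMPInv A X) (hY : IsMPInv (S * A) Y) : Y * (S * A) = X * A := by
  have hdet := (isUnit_iff_isUnit_det S).1 hS
  have hA : A * (Y * (S * A)) = A := by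
    have h := congrArg (S⁻¹ * ·) hY.1
    simpa only [Matrix.mul_assoc, nonsing_inv_mul_cancel_left _ _ hdet] using h
  refine IsHermitian.eq_of_mul_eq_left hY.2.2.2 hX.2.2.2 ?_ ?_
  · simp only [Matrix.mul_assoc]
    rw [← Matrix.mul_assoc A, hX.1]
  · rw [Matrix.mul_assoc, hA]

/-- Multiplying on the right by an invertible matrix preserves the projection `A * X`. -/
theorem IsMPInv.mul_eq_of_isUnit_right {I J : Type*} [Fintype I] [Fintype J] [DecidableEq J]
    {A : Matrix I J ℂ} {T : Matrix J J ℂ} {X Z : Matrix J I ℂ} (hT : IsUnit T)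
    (hX : IsMPInv A X) (hZ : IsMPInv (A * T) Z) : A * T * Z = A * X := by
  have hdet := (isUnit_iff_isUnit_det T).1 hT
  have hA : A * T * Z * A = A := by
    have h := congrArg (· * T⁻¹) hZ.1
    simpa only [← Matrix.mul_assoc, mul_nonsing_inv_cancel_right _ _ hdet] using h
  refine IsHermitian.eq_of_mul_eq_right hZ.2.2.1 hX.2.2.1 ?_ ?_
  · rw [← Matrix.mul_assoc, hA]
  · rw [← Matrix.mul_assoc, ← Matrix.mul_assoc, hX.1]

theorem weighted_projections_eq_unweighted
    {I J : Type*} [Fintype I] [Fintype J] [DecidableEq I] [DecidableEq J]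
    (A : Matrix I J ℂ) (M SM : Matrix I I ℂ) (N SN : Matrix J J ℂ)
    (hMh : Mᴴ = M) (hM : M.PosDef) (hNh : Nᴴ = N) (hN : N.PosDef)
    (hSMh : SMᴴ = SM) (hSM : SM.PosDef) (hSNh : SNᴴ = SN) (hSN : SN.PosDef)
    (hSM2 : SM * SM = M) (hSN2 : SN * SN = N)
    (X : Matrix J I ℂ) (hX : IsMPInv A X)
    (Y : Matrix J I ℂ) (hY : IsMPInv (SM * A) Y)
    (Z : Matrix J I ℂ) (hZ : IsMPInv (A * SN⁻¹) Z) :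
    Y * SM * A = X * A ∧ A * SN⁻¹ * Z = A * X := by
  refine ⟨?_, hX.mul_eq_of_isUnit_right (isUnit_nonsing_inv_iff.2 hSN.isUnit) hZ⟩
  rw [Matrix.mul_assoc]
  exact hX.mul_eq_of_isUnit_left hSM.isUnit hY
end

section
/- Let U : Matrix I J ℂ and V : Matrix J K ℂ, and let M : Matrix I I ℂ and N : Matrix K K ℂ be Hermitian positive definite (so that M⁻¹ and N⁻¹ are also Hermitian positive definite). Let X₁ be the weighted Moore–Penrose inverse of U with respect to (M, 1), let X₂ be the weighted Moore–Penrose inverse of V with respect to (1, N), let Y₁ be the weighted Moore–Penrose inverse of X₁ᴴ * V with respect to (M⁻¹, N), let Y₂ be the weighted Moore–Penrose inverse of U * X₂ᴴ with respect to (M, N⁻¹), and let Z be the weighted Moore–Penrose inverse of U * V with respect to (M, N). Then Z = Y₁ * (X₂ * X₁)ᴴ * Y₂. -/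
open Matrix
open scoped ComplexOrder

/-- `X` is a weighted Moore–Penrose inverse of `A` with respect to weights `M` and `N`. -/
def IsWMPInv {I J : Type*} [Fintype I] [Fintype J]
    (M : Matrix I I ℂ) (N : Matrix J J ℂ)
    (A : Matrix I J ℂ) (X : Matrix J I ℂ) : Prop :=
  A * X * A = A ∧ X * A * X = X ∧
  (M * A * X)ᴴ = M * A * X ∧ (N * X * A)ᴴ = N * X * A

/-- Two matrices that are self-adjoint for an invertible Hermitian weight `W` and absorb each other
on the right are equal. -/
theorem eq_of_weighted_isHermitian_of_absorb_right {n : Type*} [Fintype n] [DecidableEq n]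
    {W E F : Matrix n n ℂ} (hW : Wᴴ = W) (hWu : IsUnit W)
    (hE : (W * E)ᴴ = W * E) (hF : (W * F)ᴴ = W * F) (hEF : E * F = E) (hFE : F * E = F) :
    E = F := by
  rw [conjTranspose_mul, hW] at hE hF
  refine hWu.mul_left_cancel ?_
  calc W * E = (E * F)ᴴ * W := by rw [hEF, hE]
    _ = W * (F * E) := by
      rw [conjTranspose_mul, Matrix.mul_assoc, hE, ← Matrix.mul_assoc, hF, Matrix.mul_assoc]
    _ = W * F := by rw [hFE]

/-- Two matrices that are self-adjoint for an invertible Hermitian weight `W` and absorb each other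
on the left are equal. -/
theorem eq_of_weighted_isHermitian_of_absorb_left {n : Type*} [Fintype n] [DecidableEq n]
    {W E F : Matrix n n ℂ} (hW : Wᴴ = W) (hWu : IsUnit W)
    (hE : (W * E)ᴴ = W * E) (hF : (W * F)ᴴ = W * F) (hEF : E * F = F) (hFE : F * E = E) :
    E = F := by
  rw [conjTranspose_mul, hW] at hE hF
  refine hWu.mul_left_cancel ?_
  calc W * E = W * (F * E) := by rw [hFE]
    _ = (E * F)ᴴ * W := by
      rw [conjTranspose_mul, Matrix.mul_assoc, hE, ← Matrix.mul_assoc, ← hF, Matrix.mul_assoc]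
    _ = W * F := by rw [hEF, hF]

theorem wmp_product_formula
    {I J K : Type*} [Fintype I] [Fintype J] [Fintype K]
    [DecidableEq I] [DecidableEq J] [DecidableEq K]
    (U : Matrix I J ℂ) (V : Matrix J K ℂ)
    (M : Matrix I I ℂ) (N : Matrix K K ℂ)
    (hMh : Mᴴ = M) (hM : M.PosDef) (hNh : Nᴴ = N) (hN : N.PosDef)
    (X₁ : Matrix J I ℂ) (hX₁ : IsWMPInv M 1 U X₁)
    (X₂ : Matrix K J ℂ) (hX₂ : IsWMPInv 1 N V X₂)
    (Y₁ : Matrix K I ℂ) (hY₁ : IsWMPInv M⁻¹ N (X₁ᴴ * V) Y₁)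
    (Y₂ : Matrix K I ℂ) (hY₂ : IsWMPInv M N⁻¹ (U * X₂ᴴ) Y₂)
    (Z : Matrix K I ℂ) (hZ : IsWMPInv M N (U * V) Z) :
    Z = Y₁ * (X₂ * X₁)ᴴ * Y₂ := by
  obtain ⟨hU, hX₁U, -, hP⟩ := hX₁
  obtain ⟨hV, hX₂V, hQ, -⟩ := hX₂
  obtain ⟨hA, -, -, hNA⟩ := hY₁
  obtain ⟨hB, -, hMB, -⟩ := hY₂
  obtain ⟨hT, hZT, hMT, hNT⟩ := hZ
  rw [Matrix.one_mul] at hP hQ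
  have hX₁H : X₁ᴴ = X₁ᴴ * (X₁ * U) := by
    conv_lhs => rw [← hX₁U, conjTranspose_mul, hP]
  have hX₂H : X₂ᴴ = V * X₂ * X₂ᴴ := by
    conv_lhs => rw [← hX₂V, Matrix.mul_assoc, conjTranspose_mul, hQ]
  have hA_T : X₁ᴴ * V = X₁ᴴ * X₁ * (U * V) := by
    conv_lhs => rw [hX₁H]
    simp only [Matrix.mul_assoc]
  have hT_A : U * V = U * Uᴴ * (X₁ᴴ * V) := by
    conv_lhs => rw [← hU, Matrix.mul_assoc U, ← hP, conjTranspose_mul]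
    simp only [Matrix.mul_assoc]
  have hB_T : U * X₂ᴴ = U * V * (X₂ * X₂ᴴ) := by
    conv_lhs => rw [hX₂H]
    simp only [Matrix.mul_assoc]
  have hT_B : U * V = U * X₂ᴴ * (Vᴴ * V) := by
    conv_lhs => rw [← hV, ← hQ, conjTranspose_mul]
    simp only [Matrix.mul_assoc]
  generalize hTdef : U * V = T at *
  generalize hAdef : X₁ᴴ * V = A at *
  generalize hBdef : U * X₂ᴴ = B at *
  have hAZT : A * (Z * T) = A := by
    rw [hA_T, Matrix.mul_assoc, ← Matrix.mul_assoc T, hT]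
  have hTYA : T * (Y₁ * A) = T := by
    rw [hT_A, Matrix.mul_assoc, ← Matrix.mul_assoc A, hA]
  have hTZB : T * Z * B = B := by
    rw [hB_T, ← Matrix.mul_assoc, hT]
  have hBYT : B * Y₂ * T = T := by
    rw [hT_B, ← Matrix.mul_assoc, hB]
  have hrow : Y₁ * A = Z * T := by
    refine eq_of_weighted_isHermitian_of_absorb_right hNh hN.isUnit ?_ ?_ ?_ ?_
    · rw [← Matrix.mul_assoc, hNA]
    · rw [← Matrix.mul_assoc, hNT]
    · rw [Matrix.mul_assoc, hAZT]
    · rw [Matrix.mul_assoc, hTYA]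
  have hcol : B * Y₂ = T * Z := by
    refine eq_of_weighted_isHermitian_of_absorb_left hMh hM.isUnit ?_ ?_ ?_ ?_
    · rw [← Matrix.mul_assoc, hMB]
    · rw [← Matrix.mul_assoc, hMT]
    · rw [← Matrix.mul_assoc, hBYT]
    · rw [← Matrix.mul_assoc, hTZB]
  have hC : (X₂ * X₁)ᴴ = A * (X₂ * X₂ᴴ) := by
    conv_lhs => rw [conjTranspose_mul, hX₂H]
    simp only [← hAdef, Matrix.mul_assoc]
  symm
  calc Y₁ * (X₂ * X₁)ᴴ * Y₂ = Y₁ * A * (X₂ * X₂ᴴ) * Y₂ := by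
        rw [hC, ← Matrix.mul_assoc Y₁]
    _ = Z * (T * (X₂ * X₂ᴴ)) * Y₂ := by rw [hrow, Matrix.mul_assoc Z]
    _ = Z * T * Z := by rw [← hB_T, Matrix.mul_assoc, hcol, Matrix.mul_assoc]
    _ = Z := hZT
end

section
/- Let U : Matrix I J ℂ, V : Matrix J K ℂ, W : Matrix K H ℂ, and set A = U * V * W. Let M : Matrix I I ℂ and N : Matrix H H ℂ be Hermitian positive definite. Let V⁺ be the Moore–Penrose inverse of V, let P be the Moore–Penrose inverse of U * V * V⁺, let Q be the Moore–Penrose inverse of V⁺ * V * W, and set X = P * A and Y = A * Q. Let X' be the weighted Moore–Penrose inverse of X with respect to (1, N), and Y' the weighted Moore–Penrose inverse of Y with respect to (M, 1). Then the weighted Moore–Penrose inverse of A with respect to (M, N) equals X' * V * Y'. -/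
open Matrix
open scoped ComplexOrder

/-- If `a` and `b` are self-adjoint for the weight `N`, then `a * b` and `b * a` are adjoint. -/
theorem weight_mul_mul_eq {I : Type*} [Fintype I] {N a b : Matrix I I ℂ} (hN : Nᴴ = N)
    (ha : (N * a)ᴴ = N * a) (hb : (N * b)ᴴ = N * b) : N * (b * a) = (a * b)ᴴ * N := by
  rw [conjTranspose_mul, hN] at ha hb
  rw [conjTranspose_mul, Matrix.mul_assoc, ha, ← Matrix.mul_assoc, ← Matrix.mul_assoc, hb]

/-- Weighted orthogonal projections with the same kernel are equal. -/
theorem weighted_projection_eq_of_ker {I : Type*} [Fintype I] {N a b : Matrix I I ℂ}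
    (hN : N.PosDef) (ha : (N * a)ᴴ = N * a) (hb : (N * b)ᴴ = N * b)
    (hab : a * b = a) (hba : b * a = b) : a = b := by
  classical
  have h := weight_mul_mul_eq hN.1 ha hb
  rw [hab, hba] at h
  rw [conjTranspose_mul, hN.1] at ha
  exact (hN.isUnit.mul_left_cancel (h.trans ha)).symm

/-- Weighted orthogonal projections with the same range are equal. -/
theorem weighted_projection_eq_of_range {I : Type*} [Fintype I] {N a b : Matrix I I ℂ}
    (hN : N.PosDef) (ha : (N * a)ᴴ = N * a) (hb : (N * b)ᴴ = N * b)
    (hab : a * b = b) (hba : b * a = a) : a = b := by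
  classical
  have h := weight_mul_mul_eq hN.1 ha hb
  rw [hab, hba] at h
  rw [conjTranspose_mul, hN.1] at hb
  exact hN.isUnit.mul_left_cancel (h.trans hb)

/-- Hermitian matrices with Hermitian product commute; here the product is one of the factors. -/
theorem mul_eq_of_hermitian {I : Type*} [Fintype I] {a b : Matrix I I ℂ}
    (ha : aᴴ = a) (hb : bᴴ = b) (hab : a * b = b) : b * a = b := by
  simpa [conjTranspose_mul, ha, hb] using congrArg conjTranspose hab

theorem wmp_triple_product_a
    {I J K H : Type*} [Fintype I] [Fintype J] [Fintype K] [Fintype H]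
    [DecidableEq J] [DecidableEq K]
    (U : Matrix I J ℂ) (V : Matrix J K ℂ) (W : Matrix K H ℂ)
    (A : Matrix I H ℂ) (hA : A = U * V * W)
    (M : Matrix I I ℂ) (N : Matrix H H ℂ)
    (hMh : Mᴴ = M) (hM : M.PosDef) (hNh : Nᴴ = N) (hN : N.PosDef)
    (Vp : Matrix K J ℂ) (hVp : IsMPInv V Vp)
    (P : Matrix J I ℂ) (hP : IsMPInv (U * V * Vp) P)
    (Q : Matrix H K ℂ) (hQ : IsMPInv (Vp * V * W) Q)
    (X : Matrix J H ℂ) (hXdef : X = P * A)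
    (Y : Matrix I K ℂ) (hYdef : Y = A * Q)
    (X' : Matrix H J ℂ) (hX' : IsWMPInv 1 N X X')
    (Y' : Matrix K I ℂ) (hY' : IsWMPInv M 1 Y Y')
    (Z : Matrix H I ℂ) (hZ : IsWMPInv M N A Z) :
    Z = X' * V * Y' := by
  obtain ⟨hV, -, -, -⟩ := hVp
  obtain ⟨hP1, hP2, -, hP4⟩ := hP
  obtain ⟨hQ1, hQ2, hQ3, -⟩ := hQ
  obtain ⟨-, hX2, hX3, hX4⟩ := id hX'
  obtain ⟨-, hY2, hY3, hY4⟩ := id hY'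
  obtain ⟨hZ1, hZ2, hZ3, hZ4⟩ := hZ
  have hX1 := hX'.1
  have hY1 := hY'.1
  rw [Matrix.one_mul] at hX3 hY4
  rw [Matrix.mul_assoc] at hX4 hY3 hZ3 hZ4
  have hAl : A = U * V * Vp * (V * W) := by
    rw [hA]
    nth_rw 1 [← hV]
    simp only [Matrix.mul_assoc]
  have hAr : A = U * V * (Vp * V * W) := by
    rw [hAl]; simp only [Matrix.mul_assoc]
  have hUX : U * V * Vp * X = A := by
    rw [hXdef, hAl, ← Matrix.mul_assoc, ← Matrix.mul_assoc, hP1]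
  have hYW : Y * (Vp * V * W) = A := by
    rw [hYdef, hAr, Matrix.mul_assoc, Matrix.mul_assoc, ← Matrix.mul_assoc _ Q, hQ1]
  have hker : X' * X = Z * A := by
    refine weighted_projection_eq_of_ker hN hX4 hZ4 ?_ ?_
    · rw [Matrix.mul_assoc, hXdef, Matrix.mul_assoc P, ← Matrix.mul_assoc A, hZ1]
    · rw [Matrix.mul_assoc, ← hUX, Matrix.mul_assoc _ X, ← Matrix.mul_assoc X, hX1]
  have hran : Y * Y' = A * Z := by
    refine weighted_projection_eq_of_range hM hY3 hZ3 ?_ ?_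
    · rw [← Matrix.mul_assoc, ← hYW, ← Matrix.mul_assoc, hY1]
    · rw [← Matrix.mul_assoc, hYdef, ← Matrix.mul_assoc, hZ1]
  have hX'P : X' * (P * (U * V * Vp)) = X' := by
    have h := mul_eq_of_hermitian hP4 hX3 (by
      rw [← Matrix.mul_assoc, hXdef, ← Matrix.mul_assoc, hP2])
    calc X' * (P * (U * V * Vp)) = X' * (X * X' * (P * (U * V * Vp))) := by
          rw [← Matrix.mul_assoc X' (X * X'), ← Matrix.mul_assoc X' X, hX2]
      _ = X' := by rw [h, ← Matrix.mul_assoc, hX2]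
  have hQY' : Vp * V * W * Q * Y' = Y' := by
    have hYQ : Y' * Y * (Vp * V * W * Q) = Y' * Y := by
      rw [Matrix.mul_assoc, ← Matrix.mul_assoc Y, hYW, hYdef]
    have h : Vp * V * W * Q * (Y' * Y) = Y' * Y := by
      simpa [conjTranspose_mul, hQ3, hY4] using congrArg conjTranspose hYQ
    rw [← hY2, ← Matrix.mul_assoc, h]
  calc Z = Z * A * Z * (A * Z) := by rw [hZ2, ← Matrix.mul_assoc, hZ2]
    _ = X' * X * Z * (Y * Y') := by rw [hker, hran]
    _ = X' * (P * (A * Z * A) * Q) * Y' := by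
      rw [hXdef, hYdef]; simp only [Matrix.mul_assoc]
    _ = X' * (P * (U * V * Vp)) * V * (Vp * V * W * Q * Y') := by
      have hVW : V * W = V * (Vp * V * W) := by
        rw [← Matrix.mul_assoc, ← Matrix.mul_assoc, hV]
      rw [hZ1, hAl, hVW]
      simp only [Matrix.mul_assoc]
    _ = X' * V * Y' := by rw [hX'P, hQY']
end

section
/- Let U : Matrix I J ℂ, V : Matrix J K ℂ, W : Matrix K H ℂ, and set A = U * V * W. Let M : Matrix I I ℂ and N : Matrix H H ℂ be Hermitian positive definite. Let U⁺ be the Moore–Penrose inverse of U and W⁺ the Moore–Penrose inverse of W, and set X = U⁺ * A and Y = A * W⁺. Let X' be the weighted Moore–Penrose inverse of X with respect to (1, N), and Y' the weighted Moore–Penrose inverse of Y with respect to (M, 1). Then the weighted Moore–Penrose inverse of A with respect to (M, N) equals X' * V * Y'. -/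
open Matrix
open scoped ComplexOrder

/-- Left multiplication by a positive definite matrix is injective. -/
theorem Matrix.PosDef.mul_left_cancel {n m : Type*} [Fintype n] {N : Matrix n n ℂ}
    (hN : N.PosDef) {E F : Matrix n m ℂ} (h : N * E = N * F) : E = F := by
  classical
  have hdet : IsUnit N.det := (Matrix.isUnit_iff_isUnit_det N).1 hN.isUnit
  rw [← Matrix.nonsing_inv_mul_cancel_left N E hdet, h,
    Matrix.nonsing_inv_mul_cancel_left N F hdet]

/-- Two projections that are self-adjoint for the inner product defined by `N` and have the same
kernel are equal. -/
theorem Matrix.PosDef.eq_of_mul_eq_left {n : Type*} [Fintype n] {N E F : Matrix n n ℂ}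
    (hN : N.PosDef) (hE : (N * E)ᴴ = N * E) (hF : (N * F)ᴴ = N * F)
    (hEF : E * F = E) (hFE : F * E = F) : E = F := by
  have hNh : Nᴴ = N := hN.isHermitian
  rw [conjTranspose_mul, hNh] at hE hF
  apply hN.mul_left_cancel
  calc N * E = N * E * F := by rw [Matrix.mul_assoc, hEF]
    _ = Eᴴ * Fᴴ * N := by rw [← hE, Matrix.mul_assoc, ← hF, ← Matrix.mul_assoc]
    _ = N * F := by rw [← conjTranspose_mul, hFE, hF]

/-- Two projections that are self-adjoint for the inner product defined by `N` and have the same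
range are equal. -/
theorem Matrix.PosDef.eq_of_mul_eq_right {n : Type*} [Fintype n] {N E F : Matrix n n ℂ}
    (hN : N.PosDef) (hE : (N * E)ᴴ = N * E) (hF : (N * F)ᴴ = N * F)
    (hEF : E * F = F) (hFE : F * E = E) : E = F := by
  have hNh : Nᴴ = N := hN.isHermitian
  rw [conjTranspose_mul, hNh] at hE hF
  apply hN.mul_left_cancel
  calc N * E = N * F * E := by rw [Matrix.mul_assoc, hFE]
    _ = Fᴴ * Eᴴ * N := by rw [← hF, Matrix.mul_assoc, ← hE, ← Matrix.mul_assoc]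
    _ = N * F := by rw [← conjTranspose_mul, hEF, hF]

theorem wmp_triple_product_b
    {I J K H : Type*} [Fintype I] [Fintype J] [Fintype K] [Fintype H]
    [DecidableEq J] [DecidableEq K]
    (U : Matrix I J ℂ) (V : Matrix J K ℂ) (W : Matrix K H ℂ)
    (A : Matrix I H ℂ) (hA : A = U * V * W)
    (M : Matrix I I ℂ) (N : Matrix H H ℂ)
    (hMh : Mᴴ = M) (hM : M.PosDef) (hNh : Nᴴ = N) (hN : N.PosDef)
    (Up : Matrix J I ℂ) (hUp : IsMPInv U Up)
    (Wp : Matrix H K ℂ) (hWp : IsMPInv W Wp)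
    (X : Matrix J H ℂ) (hXdef : X = Up * A)
    (Y : Matrix I K ℂ) (hYdef : Y = A * Wp)
    (X' : Matrix H J ℂ) (hX' : IsWMPInv 1 N X X')
    (Y' : Matrix K I ℂ) (hY' : IsWMPInv M 1 Y Y')
    (Z : Matrix H I ℂ) (hZ : IsWMPInv M N A Z) :
    Z = X' * V * Y' := by
  obtain ⟨hU1, hU2, -, hU4⟩ := hUp
  obtain ⟨hW1, hW2, hW3, -⟩ := hWp
  obtain ⟨hX1, hX2, hX3, hX4⟩ := hX'
  obtain ⟨hY1, hY2, hY3, hY4⟩ := hY'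
  obtain ⟨hZ1, hZ2, hZ3, hZ4⟩ := hZ
  rw [Matrix.one_mul] at hX3
  rw [Matrix.one_mul] at hY4
  have hUX : U * X = A := by
    rw [hXdef, hA]
    simp only [← Matrix.mul_assoc]
    rw [hU1]
  have hYW : Y * W = A := by
    rw [hYdef, hA]
    simp only [Matrix.mul_assoc]
    rw [← Matrix.mul_assoc W Wp W, hW1]
  have hX'X : X' * X = Z * A := by
    refine hN.eq_of_mul_eq_left (by rwa [← Matrix.mul_assoc]) (by rwa [← Matrix.mul_assoc]) ?_ ?_
    · calc X' * X * (Z * A) = X' * (Up * (A * Z * A)) := by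
            rw [hXdef]; simp only [Matrix.mul_assoc]
        _ = X' * X := by rw [hZ1, hXdef]
    · calc Z * A * (X' * X) = Z * (U * (X * X' * X)) := by
            rw [← hUX]; simp only [Matrix.mul_assoc]
        _ = Z * A := by rw [hX1, hUX]
  have hYY' : Y * Y' = A * Z := by
    refine hM.eq_of_mul_eq_right (by rwa [← Matrix.mul_assoc]) (by rwa [← Matrix.mul_assoc]) ?_ ?_
    · calc Y * Y' * (A * Z) = Y * Y' * Y * W * Z := by
            rw [← hYW]; simp only [Matrix.mul_assoc]
        _ = A * Z := by rw [hY1, hYW]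
    · calc A * Z * (Y * Y') = A * Z * A * Wp * Y' := by
            rw [hYdef]; simp only [Matrix.mul_assoc]
        _ = Y * Y' := by rw [hZ1, hYdef]
  have hX'U : X' * (Up * U) = X' := by
    have h : X * X' * (Up * U) = X * X' := by
      have h' : Up * U * (X * X') = X * X' := by
        rw [hXdef]
        simp only [← Matrix.mul_assoc]
        rw [hU2]
      simpa only [conjTranspose_mul (Up * U), hX3, hU4] using congrArg conjTranspose h'
    calc X' * (Up * U) = X' * X * X' * (Up * U) := by rw [hX2]
      _ = X' * (X * X' * (Up * U)) := by simp only [Matrix.mul_assoc]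
      _ = X' := by rw [h, ← Matrix.mul_assoc, hX2]
  have hWY' : W * Wp * Y' = Y' := by
    have h : W * Wp * (Y' * Y) = Y' * Y := by
      have h' : Y' * Y * (W * Wp) = Y' * Y := by
        rw [hYdef]
        simp only [Matrix.mul_assoc]
        rw [← Matrix.mul_assoc Wp W Wp, hW2]
      simpa only [conjTranspose_mul (Y' * Y), hY4, hW3] using congrArg conjTranspose h'
    calc W * Wp * Y' = W * Wp * (Y' * Y * Y') := by rw [hY2]
      _ = W * Wp * (Y' * Y) * Y' := by simp only [Matrix.mul_assoc]
      _ = Y' := by rw [h, hY2]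
  symm
  calc X' * V * Y' = X' * (Up * U) * V * (W * Wp * Y') := by rw [hX'U, hWY']
    _ = X' * X * Wp * Y' := by rw [hXdef, hA]; simp only [Matrix.mul_assoc]
    _ = Z * (Y * Y') := by rw [hX'X, hYdef]; simp only [Matrix.mul_assoc]
    _ = Z := by rw [hYY', ← Matrix.mul_assoc, hZ2]
end

section
/- Let A : Matrix I J ℂ have rank r, let F : Matrix I (Fin r) ℂ and G : Matrix (Fin r) J ℂ satisfy A = F * G with rank F = r and rank G = r, and let M : Matrix I I ℂ and N : Matrix J J ℂ be Hermitian positive definite. Then the square matrix Fᴴ * M * A * N⁻¹ * Gᴴ : Matrix (Fin r) (Fin r) ℂ is invertible, and X := N⁻¹ * Gᴴ * (Fᴴ * M * A * N⁻¹ * Gᴴ)⁻¹ * Fᴴ * M satisfies the four weighted Penrose equations for A with respect to (M, N): A * X * A = A, X * A * X = X, (M * A * X)ᴴ = M * A * X, and (N * X * A)ᴴ = N * X * A. -/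
open Matrix
open scoped ComplexOrder

theorem Matrix.mulVec_injective_of_rank_eq_card {K m n : Type*} [Field K] [Fintype n]
    {B : Matrix m n K} (hB : B.rank = Fintype.card n) :
    Function.Injective B.mulVec := by
  rw [Matrix.mulVec_injective_iff, linearIndependent_iff_card_eq_finrank_span, ← hB,
    Matrix.rank_eq_finrank_span_cols]
  rfl

theorem wmp_via_full_rank_decomposition
    {I J : Type*} [Fintype I] [Fintype J] [DecidableEq I] [DecidableEq J]
    (A : Matrix I J ℂ) (r : ℕ) (hr : A.rank = r)
    (F : Matrix I (Fin r) ℂ) (G : Matrix (Fin r) J ℂ)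
    (hA : A = F * G) (hF : F.rank = r) (hG : G.rank = r)
    (M : Matrix I I ℂ) (N : Matrix J J ℂ)
    (hMh : Mᴴ = M) (hM : M.PosDef) (hNh : Nᴴ = N) (hN : N.PosDef) :
    IsUnit (Fᴴ * M * A * N⁻¹ * Gᴴ) ∧
    (let X : Matrix J I ℂ := N⁻¹ * Gᴴ * (Fᴴ * M * A * N⁻¹ * Gᴴ)⁻¹ * Fᴴ * M
     A * X * A = A ∧ X * A * X = X ∧
     (M * A * X)ᴴ = M * A * X ∧ (N * X * A)ᴴ = N * X * A) := by
  obtain ⟨P, hP⟩ : ∃ P, P = Fᴴ * M * F := ⟨_, rfl⟩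
  obtain ⟨Q, hQ⟩ : ∃ Q, Q = G * N⁻¹ * Gᴴ := ⟨_, rfl⟩
  have hPpos : P.PosDef := hP ▸ hM.conjTranspose_mul_mul_same
    (Matrix.mulVec_injective_of_rank_eq_card (by simpa using hF))
  have hQpos : Q.PosDef := by
    have h := hN.inv.conjTranspose_mul_mul_same (B := Gᴴ)
      (Matrix.mulVec_injective_of_rank_eq_card (by simpa [Matrix.rank_conjTranspose] using hG))
    rwa [conjTranspose_conjTranspose, ← hQ] at h
  have hPdet := (Matrix.isUnit_iff_isUnit_det P).1 hPpos.isUnit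
  have hQdet := (Matrix.isUnit_iff_isUnit_det Q).1 hQpos.isUnit
  have hNdet := (Matrix.isUnit_iff_isUnit_det N).1 hN.isUnit
  have hPQ : Fᴴ * M * A * N⁻¹ * Gᴴ = P * Q := by
    simp only [hA, hP, hQ, Matrix.mul_assoc]
  refine ⟨hPQ ▸ hPpos.isUnit.mul hQpos.isUnit, ?_⟩
  intro X
  have hX : X = N⁻¹ * Gᴴ * Q⁻¹ * (P⁻¹ * Fᴴ * M) := by
    simp only [X]
    rw [hPQ, Matrix.mul_inv_rev]
    simp only [Matrix.mul_assoc]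
  have hAX : A * X = F * P⁻¹ * Fᴴ * M := by
    calc A * X = F * ((G * N⁻¹ * Gᴴ) * Q⁻¹) * (P⁻¹ * Fᴴ * M) := by
          simp only [hA, hX, Matrix.mul_assoc]
      _ = F * P⁻¹ * Fᴴ * M := by
          rw [← hQ, Matrix.mul_nonsing_inv Q hQdet, Matrix.mul_one]
          simp only [Matrix.mul_assoc]
  have hXA : X * A = N⁻¹ * Gᴴ * Q⁻¹ * G := by
    calc X * A = N⁻¹ * Gᴴ * Q⁻¹ * (P⁻¹ * (Fᴴ * M * F)) * G := by
          simp only [hA, hX, Matrix.mul_assoc]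
      _ = N⁻¹ * Gᴴ * Q⁻¹ * G := by
          rw [← hP, Matrix.nonsing_inv_mul P hPdet, Matrix.mul_one]
  refine ⟨?_, ?_, ?_, ?_⟩
  · calc A * X * A = F * (P⁻¹ * (Fᴴ * M * F)) * G := by
          rw [hAX, hA]
          simp only [Matrix.mul_assoc]
      _ = A := by rw [← hP, Matrix.nonsing_inv_mul P hPdet, Matrix.mul_one, hA]
  · calc X * A * X = N⁻¹ * Gᴴ * (Q⁻¹ * (G * N⁻¹ * Gᴴ)) * Q⁻¹ * (P⁻¹ * Fᴴ * M) := by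
          rw [hXA, hX]
          simp only [Matrix.mul_assoc]
      _ = X := by rw [← hQ, Matrix.nonsing_inv_mul Q hQdet, Matrix.mul_one, hX]
  · rw [Matrix.mul_assoc, hAX]
    simp only [conjTranspose_mul, conjTranspose_conjTranspose, hMh, hPpos.inv.isHermitian.eq,
      Matrix.mul_assoc]
  · have h : N * (N⁻¹ * Gᴴ * Q⁻¹ * G) = Gᴴ * Q⁻¹ * G := by
      simp only [← Matrix.mul_assoc, Matrix.mul_nonsing_inv N hNdet, Matrix.one_mul]
    rw [Matrix.mul_assoc, hXA, h]
    simp only [conjTranspose_mul, conjTranspose_conjTranspose, hQpos.inv.isHermitian.eq,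
      Matrix.mul_assoc]
end

section
/- Let A : Matrix I J ℂ have rank r, and suppose A = F * G = F₁ * G₁ are two full rank decompositions, i.e. F, F₁ : Matrix I (Fin r) ℂ with rank F = rank F₁ = r and G, G₁ : Matrix (Fin r) J ℂ with rank G = rank G₁ = r. Then there exists an invertible matrix B : Matrix (Fin r) (Fin r) ℂ such that F₁ = F * B and G₁ = B⁻¹ * G; moreover, if X is the Moore–Penrose inverse of F and Y the Moore–Penrose inverse of G, then B⁻¹ * X is the Moore–Penrose inverse of F₁ and Y * B is the Moore–Penrose inverse of G₁. -/
open Matrix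

theorem Matrix.exists_right_inverse_of_rank_eq {K J : Type*} [Field K] [Fintype J] {r : ℕ}
    {G : Matrix (Fin r) J K} (hG : G.rank = r) : ∃ R : Matrix J (Fin r) K, G * R = 1 := by
  rw [← Matrix.mulVec_surjective_iff_exists_right_inverse]
  have hrange : LinearMap.range G.mulVecLin = ⊤ := by
    apply Submodule.eq_top_of_finrank_eq
    rw [Module.finrank_fin_fun]
    exact hG
  exact LinearMap.range_eq_top.mp hrange

theorem Matrix.exists_left_inverse_of_rank_eq {K I : Type*} [Field K] [Fintype I] {r : ℕ}
    {F : Matrix I (Fin r) K} (hF : F.rank = r) : ∃ L : Matrix (Fin r) I K, L * F = 1 := by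
  obtain ⟨R, hR⟩ := Matrix.exists_right_inverse_of_rank_eq (G := Fᵀ) (by rw [rank_transpose, hF])
  exact ⟨Rᵀ, by simpa using congrArg transpose hR⟩

/-- A Moore–Penrose inverse of a matrix of full column rank is a left inverse. -/
theorem IsMPInv.inv_mul_eq_one_of_rank_eq {I : Type*} [Fintype I] {r : ℕ}
    {F : Matrix I (Fin r) ℂ} {X : Matrix (Fin r) I ℂ} (hX : IsMPInv F X) (hF : F.rank = r) :
    X * F = 1 := by
  obtain ⟨L, hL⟩ := Matrix.exists_left_inverse_of_rank_eq hF
  calc X * F = L * F * (X * F) := by rw [hL, Matrix.one_mul]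
    _ = L * (F * X * F) := by simp only [Matrix.mul_assoc]
    _ = 1 := by rw [hX.1, hL]

/-- A Moore–Penrose inverse of a matrix of full row rank is a right inverse. -/
theorem IsMPInv.mul_inv_eq_one_of_rank_eq {J : Type*} [Fintype J] {r : ℕ}
    {G : Matrix (Fin r) J ℂ} {Y : Matrix J (Fin r) ℂ} (hY : IsMPInv G Y) (hG : G.rank = r) :
    G * Y = 1 := by
  obtain ⟨R, hR⟩ := Matrix.exists_right_inverse_of_rank_eq hG
  calc G * Y = G * Y * (G * R) := by rw [hR, Matrix.mul_one]
    _ = G * Y * G * R := by simp only [Matrix.mul_assoc]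
    _ = 1 := by rw [hY.1, hR]

/-- A left inverse `X` of `A` for which `A * X` is Hermitian is a Moore–Penrose inverse. -/
theorem IsMPInv.of_mul_eq_one {I K : Type*} [Fintype I] [Fintype K] [DecidableEq K]
    {A : Matrix I K ℂ} {X : Matrix K I ℂ} (h : X * A = 1) (hH : (A * X)ᴴ = A * X) :
    IsMPInv A X :=
  ⟨by rw [Matrix.mul_assoc, h, Matrix.mul_one], by rw [h, Matrix.one_mul], hH,
    by rw [h, conjTranspose_one]⟩

theorem IsMPInv.symm {I J : Type*} [Fintype I] [Fintype J]
    {A : Matrix I J ℂ} {X : Matrix J I ℂ} (h : IsMPInv A X) : IsMPInv X A :=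
  ⟨h.2.1, h.1, h.2.2.2, h.2.2.1⟩

theorem full_rank_decompositions_related
    {I J : Type*} [Fintype I] [Fintype J]
    (A : Matrix I J ℂ) (r : ℕ) (hr : A.rank = r)
    (F F₁ : Matrix I (Fin r) ℂ) (G G₁ : Matrix (Fin r) J ℂ)
    (hFG : A = F * G) (hFG₁ : A = F₁ * G₁)
    (hF : F.rank = r) (hF₁ : F₁.rank = r) (hG : G.rank = r) (hG₁ : G₁.rank = r)
    (X : Matrix (Fin r) I ℂ) (hX : IsMPInv F X)
    (Y : Matrix J (Fin r) ℂ) (hY : IsMPInv G Y) :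
    ∃ B : Matrix (Fin r) (Fin r) ℂ, IsUnit B ∧
      F₁ = F * B ∧ G₁ = B⁻¹ * G ∧
      IsMPInv F₁ (B⁻¹ * X) ∧ IsMPInv G₁ (Y * B) := by
  have hXF := hX.inv_mul_eq_one_of_rank_eq hF
  have hGY := hY.mul_inv_eq_one_of_rank_eq hG
  obtain ⟨L, hL⟩ := Matrix.exists_left_inverse_of_rank_eq hF₁
  obtain ⟨R, hR⟩ := Matrix.exists_right_inverse_of_rank_eq hG₁
  have hA : F * G = F₁ * G₁ := hFG.symm.trans hFG₁
  obtain ⟨B, hB⟩ : ∃ B, B = G * R := ⟨_, rfl⟩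
  have hFB : F₁ = F * B := by
    rw [hB, ← Matrix.mul_assoc, hA, Matrix.mul_assoc, hR, Matrix.mul_one]
  have hXF₁ : X * F₁ = B := by rw [hFB, ← Matrix.mul_assoc, hXF, Matrix.one_mul]
  have hBG : B * G₁ = G := by
    rw [← hXF₁, Matrix.mul_assoc, ← hA, ← Matrix.mul_assoc, hXF, Matrix.one_mul]
  have hLB : L * F * B = 1 := by rw [Matrix.mul_assoc, ← hFB, hL]
  have hdet : IsUnit B.det := Matrix.isUnit_det_of_left_inverse hLB
  have hGB : G₁ = B⁻¹ * G := by rw [← hBG, Matrix.nonsing_inv_mul_cancel_left _ _ hdet]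
  refine ⟨B, (Matrix.isUnit_iff_isUnit_det B).mpr hdet, hFB, hGB, ?_, ?_⟩
  · apply IsMPInv.of_mul_eq_one
    · rw [Matrix.mul_assoc, hXF₁, Matrix.nonsing_inv_mul _ hdet]
    · have h : F₁ * (B⁻¹ * X) = F * X := by
        rw [hFB, Matrix.mul_assoc, Matrix.mul_nonsing_inv_cancel_left _ _ hdet]
      rw [h, hX.2.2.1]
  · apply IsMPInv.symm
    apply IsMPInv.of_mul_eq_one
    · rw [hGB, Matrix.mul_assoc, ← Matrix.mul_assoc G, hGY, Matrix.one_mul,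
        Matrix.nonsing_inv_mul _ hdet]
    · rw [Matrix.mul_assoc, hBG, hY.2.2.2]
end

section
/- Let A : Matrix I J ℂ and B : Matrix J K ℂ, and let M : Matrix I I ℂ and N : Matrix K K ℂ be Hermitian positive definite. Let X be the weighted Moore–Penrose inverse of A with respect to (M, 1), let Y be the weighted Moore–Penrose inverse of B with respect to (1, N), and let Z be the weighted Moore–Penrose inverse of A * B with respect to (M, N). If R(B) = R(Aᴴ), then Z = Y * X. -/
open Matrix
open scoped ComplexOrder

theorem Matrix.PosDef.mul_left_cancel_s17 {I J : Type*} [Fintype I]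
    {M : Matrix I I ℂ} (hM : M.PosDef) {U V : Matrix I J ℂ} (h : M * U = M * V) : U = V := by
  classical
  have : Invertible M := hM.isUnit.invertible
  simpa using congrArg (fun W => ⅟M * W) h

/-- A matrix fixing the columns of `D` fixes every matrix whose range lies in that of `D`. -/
theorem Matrix.mul_eq_self_of_range_subset {I J K : Type*} [Fintype I] [Fintype J] [Fintype K]
    {P : Matrix I I ℂ} {C : Matrix I J ℂ} {D : Matrix I K ℂ}
    (h : Set.range C.mulVec ⊆ Set.range D.mulVec) (hP : P * D = D) : P * C = C := by
  refine Matrix.mulVec_injective (funext fun x => ?_)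
  obtain ⟨y, hy⟩ := h ⟨x, rfl⟩
  rw [← Matrix.mulVec_mulVec, ← hy, Matrix.mulVec_mulVec, hP]

theorem IsWMPInv.unique {I J : Type*} [Fintype I] [Fintype J]
    {M : Matrix I I ℂ} {N : Matrix J J ℂ} (hM : M.PosDef) (hN : N.PosDef)
    {A : Matrix I J ℂ} {X Y : Matrix J I ℂ}
    (hX : IsWMPInv M N A X) (hY : IsWMPInv M N A Y) : X = Y := by
  obtain ⟨hX₁, hX₂, hX₃, hX₄⟩ := hX
  obtain ⟨hY₁, hY₂, hY₃, hY₄⟩ := hY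
  have hMh : Mᴴ = M := hM.isHermitian
  have hNh : Nᴴ = N := hN.isHermitian
  have left : A * X = A * Y := by
    refine hM.mul_left_cancel_s17 ?_
    calc M * (A * X) = M * A * Y * (A * X) := by
          conv_lhs => rw [← hY₁]
          simp only [Matrix.mul_assoc]
      _ = (A * Y)ᴴ * (M * A * X) := by
          rw [← hY₃]
          simp only [conjTranspose_mul, hMh, Matrix.mul_assoc]
      _ = (M * (A * X * A) * Y)ᴴ := by
          rw [← hX₃]
          simp only [conjTranspose_mul, hMh, Matrix.mul_assoc]
      _ = M * (A * Y) := by rw [hX₁, hY₃, Matrix.mul_assoc]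
  have right : X * A = Y * A := by
    refine hN.mul_left_cancel_s17 ?_
    calc N * (X * A) = N * X * A * (Y * A) := by
          conv_lhs => rw [← hY₁]
          simp only [Matrix.mul_assoc]
      _ = (X * A)ᴴ * (N * Y * A) := by
          rw [← hX₄]
          simp only [conjTranspose_mul, hNh, Matrix.mul_assoc]
      _ = (N * Y * (A * X * A))ᴴ := by
          rw [← hY₄]
          simp only [conjTranspose_mul, hNh, Matrix.mul_assoc]
      _ = N * (Y * A) := by rw [hX₁, hY₄, Matrix.mul_assoc]
  rw [← hX₂, right, Matrix.mul_assoc, left, ← Matrix.mul_assoc, hY₂]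

theorem wmp_reverse_order_of_range_eq
    {I J K : Type*} [Fintype I] [Fintype J] [Fintype K]
    [DecidableEq J]
    (A : Matrix I J ℂ) (B : Matrix J K ℂ)
    (M : Matrix I I ℂ) (N : Matrix K K ℂ)
    (hMh : Mᴴ = M) (hM : M.PosDef) (hNh : Nᴴ = N) (hN : N.PosDef)
    (X : Matrix J I ℂ) (hX : IsWMPInv M 1 A X)
    (Y : Matrix K J ℂ) (hY : IsWMPInv 1 N B Y)
    (Z : Matrix K I ℂ) (hZ : IsWMPInv M N (A * B) Z)
    (hR : Set.range B.mulVec = Set.range Aᴴ.mulVec) :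
    Z = Y * X := by
  obtain ⟨hX₁, hX₂, hX₃, hX₄⟩ := hX
  obtain ⟨hY₁, hY₂, hY₃, hY₄⟩ := hY
  rw [Matrix.one_mul] at hX₄ hY₃
  have hXAB : X * A * B = B := by
    refine Matrix.mul_eq_self_of_range_subset hR.subset ?_
    rw [← hX₄, ← conjTranspose_mul, ← Matrix.mul_assoc, hX₁]
  have hABY : A * (B * Y) = A := by
    have h := Matrix.mul_eq_self_of_range_subset hR.superset hY₁
    rw [← hY₃, ← conjTranspose_mul] at h
    exact conjTranspose_injective h
  have hBY : B * Y = X * A := by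
    rw [← hXAB, Matrix.mul_assoc (X * A), Matrix.mul_assoc X, hABY]
  refine hZ.unique hM hN ⟨?_, ?_, ?_, ?_⟩
  · calc A * B * (Y * X) * (A * B) = A * (B * Y) * (X * A * B) := by
          simp only [Matrix.mul_assoc]
      _ = A * B := by rw [hABY, hXAB]
  · calc Y * X * (A * B) * (Y * X) = Y * (X * A * B) * Y * X := by
          simp only [Matrix.mul_assoc]
      _ = Y * X * A * X := by
          rw [hXAB, Matrix.mul_assoc Y, hBY, ← Matrix.mul_assoc]
      _ = Y * X := by rw [Matrix.mul_assoc Y, Matrix.mul_assoc Y, hX₂]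
  · have h : M * (A * B) * (Y * X) = M * A * X := by
      calc M * (A * B) * (Y * X) = M * (A * (B * Y)) * X := by simp only [Matrix.mul_assoc]
        _ = M * A * X := by rw [hABY]
    rw [h, hX₃]
  · have h : N * (Y * X) * (A * B) = N * Y * B := by
      calc N * (Y * X) * (A * B) = N * Y * (X * A * B) := by simp only [Matrix.mul_assoc]
        _ = N * Y * B := by rw [hXAB]
    rw [h, hY₄]
end
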